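/- Let t ≥ 1 and let W₊, W₋ be symmetric 0-1 matrices of size 4t×4t with W₊ + W₋ = J_{4t} − I_t ⊗ J₄ and (W₊ − W₋)² = 4(t − 1)·I_{4t} (so W = W₊ − W₋ is a symmetric weighing matrix W(4t, 4(t−1)) whose main diagonal consists of 4×4 zero blocks). Let A = W₊ ⊗ I₂ + W₋ ⊗ (J₂ − I₂) + I_t ⊗ ((J₄ − I₄) ⊗ J₂) (the matrix obtained by replacing each 0 of W by O₂, each +1 by I₂, each −1 by J₂ − I₂, and adding I_t ⊗ ((J₄−I₄) ⊗ J₂)). Then A satisfies A² = (4t + 2)·I + 6·(K − I) + (2t + 2)·(J − K), where K = I_{4t} ⊗ J₂ and J is the all-ones 8t×8t matrix; that is, A is the adjacency matrix of a divisible design graph with parameters (8t, 4t + 2, 6, 2t + 2, 4t, 2). -/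

import Mathlib

open Matrix Kronecker

/-- The all-ones matrix. -/
def allOnes (ι : Type*) : Matrix ι ι ℝ := Matrix.of fun _ _ => 1

/-- `A` is the adjacency matrix of a divisible design graph whose canonical
partition has classes indexed by `cl` and class members indexed by `pt`. -/
def IsDDGAdj {cl pt : Type*} [Fintype cl] [DecidableEq cl] [Fintype pt] [DecidableEq pt]
    (k l1 l2 : ℝ) (A : Matrix (cl × pt) (cl × pt) ℝ) : Prop :=
  A.IsSymm ∧ (∀ x y, A x y = 0 ∨ A x y = 1) ∧ (∀ x, A x x = 0) ∧
  A * A = k • (1 : Matrix (cl × pt) (cl × pt) ℝ)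
      + l1 • ((1 : Matrix cl cl ℝ) ⊗ₖ allOnes pt - 1)
      + l2 • (allOnes (cl × pt) - (1 : Matrix cl cl ℝ) ⊗ₖ allOnes pt)

/-- The matrix `I_t ⊗ ((J₄ − I₄) ⊗ J₂)`: within each of the `t` groups of four classes,
all vertices of distinct classes are joined. -/
def multipartitePart (t : ℕ) :
    Matrix ((Fin t × Fin 4) × Fin 2) ((Fin t × Fin 4) × Fin 2) ℝ :=
  Matrix.of fun x y => if x.1.1 = y.1.1 ∧ x.1.2 ≠ y.1.2 then 1 else 0

theorem kronecker_sub_right {ι κ : Type*} (A : Matrix ι ι ℝ) (B C : Matrix κ κ ℝ) :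
    A ⊗ₖ (B - C) = A ⊗ₖ B - A ⊗ₖ C := by
  ext x y
  simp [mul_sub]

theorem allOnes_mul_allOnes (ι : Type*) [Fintype ι] :
    allOnes ι * allOnes ι = (Fintype.card ι : ℝ) • allOnes ι := by
  ext x y
  simp [allOnes, Matrix.mul_apply]

theorem allOnes_kronecker_allOnes (ι κ : Type*) :
    allOnes ι ⊗ₖ allOnes κ = allOnes (ι × κ) := by
  ext x y
  simp [allOnes]

/-- The square of `½ (J + I_t ⊗ J₄) - I`, the quotient of the construction by its canonical
partition, up to a factor of two. -/
theorem quotient_mul_self (t : ℕ) :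
    ((1 / 2 : ℝ) • (allOnes (Fin t × Fin 4)
        + (1 : Matrix (Fin t) (Fin t) ℝ) ⊗ₖ allOnes (Fin 4)) - 1)
      * ((1 / 2 : ℝ) • (allOnes (Fin t × Fin 4)
        + (1 : Matrix (Fin t) (Fin t) ℝ) ⊗ₖ allOnes (Fin 4)) - 1)
      = ((t : ℝ) + 1) • allOnes (Fin t × Fin 4) + 1 := by
  have hJJ : allOnes (Fin t × Fin 4) * allOnes (Fin t × Fin 4)
      = (4 * (t : ℝ)) • allOnes (Fin t × Fin 4) := by
    rw [allOnes_mul_allOnes]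
    simp [mul_comm]
  have hBB : ((1 : Matrix (Fin t) (Fin t) ℝ) ⊗ₖ allOnes (Fin 4))
      * ((1 : Matrix (Fin t) (Fin t) ℝ) ⊗ₖ allOnes (Fin 4))
      = (4 : ℝ) • ((1 : Matrix (Fin t) (Fin t) ℝ) ⊗ₖ allOnes (Fin 4)) := by
    rw [← mul_kronecker_mul, allOnes_mul_allOnes, kronecker_smul]
    simp
  have hJB : allOnes (Fin t × Fin 4) * ((1 : Matrix (Fin t) (Fin t) ℝ) ⊗ₖ allOnes (Fin 4))
      = (4 : ℝ) • allOnes (Fin t × Fin 4) := by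
    rw [← allOnes_kronecker_allOnes, ← mul_kronecker_mul, allOnes_mul_allOnes, kronecker_smul]
    simp
  have hBJ : ((1 : Matrix (Fin t) (Fin t) ℝ) ⊗ₖ allOnes (Fin 4)) * allOnes (Fin t × Fin 4)
      = (4 : ℝ) • allOnes (Fin t × Fin 4) := by
    rw [← allOnes_kronecker_allOnes, ← mul_kronecker_mul, allOnes_mul_allOnes, kronecker_smul]
    simp
  simp only [sub_mul, mul_sub, add_mul, mul_add, smul_mul_assoc, mul_smul_comm, mul_one,
    one_mul, hJJ, hBB, hJB, hBJ]
  module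

/-- Squares of matrices decomposed along the orthogonal pair `J₂`, `2 I - J₂`. -/
theorem kronecker_decomposition_mul_self {ι : Type*} [Fintype ι] (N D : Matrix ι ι ℝ) :
    (N ⊗ₖ allOnes (Fin 2) + D ⊗ₖ ((2 : ℝ) • (1 : Matrix (Fin 2) (Fin 2) ℝ) - allOnes (Fin 2)))
      * (N ⊗ₖ allOnes (Fin 2)
        + D ⊗ₖ ((2 : ℝ) • (1 : Matrix (Fin 2) (Fin 2) ℝ) - allOnes (Fin 2)))
      = (2 : ℝ) • ((N * N) ⊗ₖ allOnes (Fin 2)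
        + (D * D) ⊗ₖ ((2 : ℝ) • (1 : Matrix (Fin 2) (Fin 2) ℝ) - allOnes (Fin 2))) := by
  have hJ : allOnes (Fin 2) * allOnes (Fin 2) = (2 : ℝ) • allOnes (Fin 2) := by
    simp [allOnes_mul_allOnes]
  simp only [add_mul, mul_add, ← mul_kronecker_mul, sub_mul, mul_sub, smul_mul_assoc,
    mul_smul_comm, mul_one, one_mul, hJ, sub_self, kronecker_sub_right, kronecker_smul]
  module

/-- From a symmetric weighing matrix `W = W₊ − W₋` of order `4t` and weight `4(t−1)` whose
main diagonal consists of `4 × 4` zero blocks, replacing each `0` by `O₂`, each `+1` by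
`I₂`, each `−1` by `J₂ − I₂` and adding `I_t ⊗ ((J₄ − I₄) ⊗ J₂)` yields the adjacency
matrix of a divisible design graph with parameters `(8t, 4t + 2, 6, 2t + 2, 4t, 2)`. -/
theorem ddg_construction_weighing (t : ℕ) (ht : 1 ≤ t)
    (Wp Wm : Matrix (Fin t × Fin 4) (Fin t × Fin 4) ℝ)
    (hWpSym : Wp.IsSymm) (hWmSym : Wm.IsSymm)
    (hWp01 : ∀ x y, Wp x y = 0 ∨ Wp x y = 1)
    (hWm01 : ∀ x y, Wm x y = 0 ∨ Wm x y = 1)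
    (hsupp : Wp + Wm = allOnes (Fin t × Fin 4)
        - (1 : Matrix (Fin t) (Fin t) ℝ) ⊗ₖ allOnes (Fin 4))
    (hW : (Wp - Wm) * (Wp - Wm)
        = (4 * ((t : ℝ) - 1)) • (1 : Matrix (Fin t × Fin 4) (Fin t × Fin 4) ℝ)) :
    IsDDGAdj (4 * (t : ℝ) + 2) 6 (2 * (t : ℝ) + 2)
      (Wp ⊗ₖ (1 : Matrix (Fin 2) (Fin 2) ℝ) + Wm ⊗ₖ (allOnes (Fin 2) - 1)
        + multipartitePart t) := by
  have hentry (x y : Fin t × Fin 4) : Wp x y + Wm x y = if x.1 = y.1 then 0 else 1 := by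
    have h := congrFun (congrFun hsupp x) y
    by_cases hxy : x.1 = y.1 <;> simpa [allOnes, kroneckerMap_apply, Matrix.one_apply, hxy] using h
  have hzero (x y : Fin t × Fin 4) (hxy : x.1 = y.1) : Wp x y = 0 ∧ Wm x y = 0 := by
    have h := hentry x y
    rw [if_pos hxy] at h
    rcases hWp01 x y with hp | hp <;> rcases hWm01 x y with hm | hm <;>
      constructor <;> linarith
  refine ⟨?_, ?_, ?_, ?_⟩
  · ext ⟨⟨i, a⟩, r⟩ ⟨⟨j, b⟩, s⟩
    simp [multipartitePart, allOnes, Matrix.one_apply, hWpSym.apply (i, a) (j, b),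
      hWmSym.apply (i, a) (j, b), eq_comm]
  · rintro ⟨x, r⟩ ⟨y, s⟩
    by_cases hxy : x.1 = y.1
    · obtain ⟨hp, hm⟩ := hzero x y hxy
      by_cases hab : x.2 = y.2 <;> simp [multipartitePart, hp, hm, hxy, hab]
    · have h := hentry x y
      rw [if_neg hxy] at h
      have hm : Wm x y = 1 - Wp x y := by linarith
      rcases hWp01 x y with hp | hp <;> by_cases hrs : r = s <;>
        simp [multipartitePart, allOnes, hm, hp, hxy, hrs]
  · rintro ⟨x, r⟩
    obtain ⟨hp, hm⟩ := hzero x x rfl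
    simp [multipartitePart, hp, hm]
  · have hA : Wp ⊗ₖ (1 : Matrix (Fin 2) (Fin 2) ℝ) + Wm ⊗ₖ (allOnes (Fin 2) - 1)
          + multipartitePart t
        = ((1 / 2 : ℝ) • (allOnes (Fin t × Fin 4)
            + (1 : Matrix (Fin t) (Fin t) ℝ) ⊗ₖ allOnes (Fin 4)) - 1) ⊗ₖ allOnes (Fin 2)
          + ((1 / 2 : ℝ) • (Wp - Wm)) ⊗ₖ
            ((2 : ℝ) • (1 : Matrix (Fin 2) (Fin 2) ℝ) - allOnes (Fin 2)) := by
      ext ⟨⟨i, a⟩, r⟩ ⟨⟨j, b⟩, s⟩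
      have h := hentry (i, a) (j, b)
      by_cases hij : i = j <;> by_cases hab : a = b <;> by_cases hrs : r = s <;>
        simp [multipartitePart, allOnes, hij, hab, hrs] at h ⊢ <;> linarith
    rw [hA, kronecker_decomposition_mul_self, quotient_mul_self, smul_mul_smul_comm, hW,
      ← allOnes_kronecker_allOnes (Fin t × Fin 4) (Fin 2)]
    simp only [add_kronecker, kronecker_sub_right, smul_kronecker, kronecker_smul,
      one_kronecker_one]
    module
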